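/- arXiv:2506.16102 — 2 statements merged into one kernel-verified Lean document; each statement's English description precedes it below -/
import Mathlib

section
/- Let (Ω, 𝒫) be a probability space, let X : Ω → ℝ be a random variable with law ν, let Z : Ω → ℝ be independent of X with law γ_σ (Gaussian, mean 0, variance σ², σ > 0), and let κ = condDistrib X (X+Z) be the regular conditional distribution of X given X + Z. If μ is a probability measure on ℝ with μ ≠ ν and KL(μ ‖ ν) < ∞, then KL((μ ∗ γ_σ).bind κ ‖ ν) < KL(μ ‖ ν). (Strict form of the paper's Theorem 1 with the exact stochastic denoiser: when the decoded-image distribution differs from the source distribution, adding Gaussian noise and applying the exact posterior denoising kernel strictly decreases the KL divergence to the source distribution.) -/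
open MeasureTheory ProbabilityTheory

/- Kullback–Leibler divergence: `∫ log (dμ/dν) dμ` if `μ ≪ ν` (and the log-likelihood ratio
is integrable), and `+∞` otherwise. -/
open scoped Classical in
noncomputable def klDiv {α : Type*} [MeasurableSpace α] (μ ν : Measure α) : EReal :=
  if μ ≪ ν ∧ Integrable (llr μ ν) μ then ((∫ x, llr μ ν x ∂μ : ℝ) : EReal) else ⊤

lemma klDiv_eq_coe_informationTheory {α : Type*} [MeasurableSpace α] (μ ν : Measure α)
    [IsProbabilityMeasure μ] [IsProbabilityMeasure ν] :
    klDiv μ ν = (InformationTheory.klDiv μ ν : EReal) := by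
  unfold klDiv
  split_ifs with h
  · have h_toReal := InformationTheory.toReal_klDiv_of_measure_eq h.1 (by simp)
    rw [← h_toReal, EReal.coe_ennreal_toReal (InformationTheory.klDiv_ne_top h.1 h.2)]
  · rw [InformationTheory.klDiv_eq_top_iff.mpr fun h1 h2 ↦ h ⟨h1, h2⟩]
    rfl

/-- The joint law of `(x + z, x)`, where `x` and `z` are independent with laws `μ` and `ρ`. -/
noncomputable def convJoint (μ ρ : Measure ℝ) : Measure (ℝ × ℝ) :=
  (μ.prod ρ).map fun p ↦ (p.1 + p.2, p.1)

instance (μ ρ : Measure ℝ) [IsProbabilityMeasure μ] [IsProbabilityMeasure ρ] :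
    IsProbabilityMeasure (convJoint μ ρ) :=
  Measure.isProbabilityMeasure_map (by fun_prop)

lemma fst_convJoint (μ ρ : Measure ℝ) : (convJoint μ ρ).fst = μ.conv ρ := by
  rw [convJoint, Measure.fst_map_prodMk (by fun_prop)]
  rfl

lemma measurableEmbedding_convJoint :
    MeasurableEmbedding fun p : ℝ × ℝ ↦ (p.1 + p.2, p.1) :=
  Measurable.measurableEmbedding (by fun_prop) fun p q h ↦ by
    simp only [Prod.mk.injEq] at h
    ext <;> linarith [h.1, h.2]

lemma klDiv_convJoint_le (μ ν ρ : Measure ℝ) [IsProbabilityMeasure μ] [IsProbabilityMeasure ν]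
    [IsProbabilityMeasure ρ] :
    InformationTheory.klDiv (convJoint μ ρ) (convJoint ν ρ) ≤ InformationTheory.klDiv μ ν := by
  refine (InformationTheory.klDiv_map_le _ _ (by fun_prop)).trans_eq ?_
  rw [← Measure.compProd_const, ← Measure.compProd_const, InformationTheory.klDiv_compProd_left]

/-- If the Radon–Nikodym derivative of `μ` with respect to `ν` is a.e. constant, then `μ = ν`. -/
lemma eq_of_rnDeriv_ae_eq_const {α : Type*} [MeasurableSpace α] {μ ν : Measure α}
    [IsProbabilityMeasure μ] [IsProbabilityMeasure ν] (hμν : μ ≪ ν) {c : ENNReal}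
    (h : μ.rnDeriv ν =ᵐ[ν] fun _ ↦ c) : μ = ν := by
  have h_smul : μ = c • ν := by
    rw [← withDensity_const, ← withDensity_congr_ae h, Measure.withDensity_rnDeriv_eq _ _ hμν]
  have hc : c = 1 := by simpa using (congrArg (fun m : Measure α ↦ m Set.univ) h_smul).symm
  rw [h_smul, hc, one_smul]

/-- If two priors on `ℝ` share the same posterior kernel under additive noise whose law has full
support up to Lebesgue-null sets, then they are equal. -/
lemma eq_of_convJoint_eq_compProd {μ ν ρ : Measure ℝ} [IsProbabilityMeasure μ]
    [IsProbabilityMeasure ν] [IsProbabilityMeasure ρ] (hρ : volume ≪ ρ) (hμν : μ ≪ ν)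
    {κ : Kernel ℝ ℝ} [IsMarkovKernel κ] (hμ : convJoint μ ρ = (μ.conv ρ) ⊗ₘ κ)
    (hν : convJoint ν ρ = (ν.conv ρ) ⊗ₘ κ) : μ = ν := by
  have h_post : ∀ᵐ p ∂ν.prod ρ, (convJoint μ ρ).rnDeriv (convJoint ν ρ) (p.1 + p.2, p.1)
      = (μ.conv ρ).rnDeriv (ν.conv ρ) (p.1 + p.2) := by
    have h := rnDeriv_measure_compProd_left (μ.conv ρ) (ν.conv ρ) κ
    rw [← hμ, ← hν] at h
    exact ae_of_ae_map (by fun_prop) h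
  have h_prior : (μ.prod ρ).rnDeriv (ν.prod ρ) =ᵐ[ν.prod ρ] fun p ↦ μ.rnDeriv ν p.1 := by
    have h := rnDeriv_measure_compProd_left μ ν (Kernel.const ℝ ρ)
    rwa [Measure.compProd_const, Measure.compProd_const] at h
  have h_eq : ∀ᵐ p ∂ν.prod ρ,
      μ.rnDeriv ν p.1 = (μ.conv ρ).rnDeriv (ν.conv ρ) (p.1 + p.2) := by
    filter_upwards [h_post, h_prior,
      measurableEmbedding_convJoint.rnDeriv_map (μ.prod ρ) (ν.prod ρ)] with p h1 h2 h3
    rw [← h1, ← h2, ← h3]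
    rfl
  have h_const : ∀ᵐ x ∂ν, ∀ᵐ y : ℝ, μ.rnDeriv ν x = (μ.conv ρ).rnDeriv (ν.conv ρ) y := by
    filter_upwards [Measure.ae_ae_of_ae_prod h_eq] with x hx
    have h := (measurePreserving_sub_right volume x).quasiMeasurePreserving.ae (hρ.ae_le hx)
    filter_upwards [h] with y hy
    simpa using hy
  obtain ⟨x₀, hx₀⟩ := h_const.exists
  refine eq_of_rnDeriv_ae_eq_const hμν (c := μ.rnDeriv ν x₀) ?_
  filter_upwards [h_const] with x hx
  obtain ⟨y, hy, hy₀⟩ := (hx.and hx₀).exists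
  rw [hy, hy₀]

/-- Adding noise of law `ρ` and then sampling from the posterior kernel of the prior `ν` strictly
decreases the Kullback–Leibler divergence to `ν`. -/
lemma informationTheory_klDiv_bind_conv_lt {μ ν ρ : Measure ℝ} [IsProbabilityMeasure μ]
    [IsProbabilityMeasure ν] [IsProbabilityMeasure ρ] (hρ : volume ≪ ρ) (hne : μ ≠ ν)
    (hfin : InformationTheory.klDiv μ ν ≠ ⊤) {κ : Kernel ℝ ℝ} [IsMarkovKernel κ]
    (hν : convJoint ν ρ = (ν.conv ρ) ⊗ₘ κ) :
    InformationTheory.klDiv ((μ.conv ρ).bind κ) ν < InformationTheory.klDiv μ ν := by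
  have h_bind : (ν.conv ρ).bind κ = ν := by
    rw [← Measure.snd_compProd, ← hν, convJoint, Measure.snd_map_prodMk (by fun_prop)]
    exact Measure.fst_prod
  have h_disint : convJoint μ ρ = (μ.conv ρ) ⊗ₘ (convJoint μ ρ).condKernel := by
    conv_lhs => rw [← (convJoint μ ρ).disintegrate (convJoint μ ρ).condKernel, fst_convJoint]
  have h_chain := klDiv_convJoint_le μ ν ρ
  rw [hν, h_disint, InformationTheory.klDiv_compProd_eq_add, ← h_disint] at h_chain
  have h_pos : InformationTheory.klDiv (convJoint μ ρ) ((μ.conv ρ) ⊗ₘ κ) ≠ 0 := fun h0 ↦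
    hne <| eq_of_convJoint_eq_compProd hρ (InformationTheory.klDiv_ne_top_iff.mp hfin).1
      (InformationTheory.klDiv_eq_zero_iff.mp h0) hν
  calc InformationTheory.klDiv ((μ.conv ρ).bind κ) ν
  _ = InformationTheory.klDiv ((μ.conv ρ).bind κ) ((ν.conv ρ).bind κ) := by rw [h_bind]
  _ ≤ InformationTheory.klDiv (μ.conv ρ) (ν.conv ρ) :=
    InformationTheory.klDiv_comp_right_le _ _ κ
  _ < InformationTheory.klDiv (μ.conv ρ) (ν.conv ρ)
      + InformationTheory.klDiv (convJoint μ ρ) ((μ.conv ρ) ⊗ₘ κ) :=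
    ENNReal.lt_add_right (ne_top_of_le_ne_top hfin (le_self_add.trans h_chain)) h_pos
  _ ≤ InformationTheory.klDiv μ ν := h_chain

/-- Strict decrease of `klDiv` for denoising with the posterior of `X` given `X + Z`, for additive
noise `Z` of any law `ρ` such that `volume ≪ ρ`. -/
lemma klDiv_bind_condDistrib_conv_lt {Ω : Type*} [MeasurableSpace Ω] {P : Measure Ω}
    [IsProbabilityMeasure P] {X Z : Ω → ℝ} (hX : Measurable X) (hZ : Measurable Z)
    (hindep : IndepFun X Z P) {μ ν ρ : Measure ℝ} (hXlaw : P.map X = ν) (hZlaw : P.map Z = ρ)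
    (hρ : volume ≪ ρ) [IsProbabilityMeasure μ] (hμν : μ ≠ ν) (hfin : klDiv μ ν < ⊤) :
    klDiv ((μ.conv ρ).bind (condDistrib X (fun ω ↦ X ω + Z ω) P)) ν < klDiv μ ν := by
  have : IsProbabilityMeasure ν := hXlaw ▸ Measure.isProbabilityMeasure_map hX.aemeasurable
  have : IsProbabilityMeasure ρ := hZlaw ▸ Measure.isProbabilityMeasure_map hZ.aemeasurable
  rw [klDiv_eq_coe_informationTheory] at hfin
  rw [klDiv_eq_coe_informationTheory, klDiv_eq_coe_informationTheory]
  have h_joint : P.map (fun ω ↦ (X ω, Z ω)) = ν.prod ρ := by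
    rw [(indepFun_iff_map_prod_eq_prod_map_map hX.aemeasurable hZ.aemeasurable).mp hindep,
      hXlaw, hZlaw]
  have h_sum : P.map (fun ω ↦ X ω + Z ω) = ν.conv ρ := by
    rw [Measure.conv, ← h_joint, Measure.map_map (by fun_prop) (by fun_prop)]
    rfl
  refine EReal.coe_ennreal_lt_coe_ennreal_iff.mpr
    (informationTheory_klDiv_bind_conv_lt hρ hμν ?_ ?_)
  · exact fun h ↦ by simp [h] at hfin
  · rw [← h_sum, compProd_map_condDistrib hX.aemeasurable, convJoint, ← h_joint,
      Measure.map_map (by fun_prop) (by fun_prop)]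
    rfl

/-- Strict form of Theorem 1 of the paper with the exact stochastic denoiser: when μ ≠ ν and
KL(μ‖ν) < ∞, adding Gaussian noise of variance σ² and applying the exact posterior denoising
kernel of ν strictly decreases the KL divergence to ν. -/
theorem klDiv_bind_condDistrib_conv_gaussian_lt {Ω : Type*} [MeasurableSpace Ω]
    (P : Measure Ω) [IsProbabilityMeasure P] (σ : ℝ) (hσ : 0 < σ)
    (X Z : Ω → ℝ) (hX : Measurable X) (hZ : Measurable Z)
    (hindep : IndepFun X Z P) (ν : Measure ℝ) (hXlaw : P.map X = ν)
    (hZlaw : P.map Z = gaussianReal 0 ⟨σ ^ 2, sq_nonneg σ⟩)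
    (μ : Measure ℝ) [IsProbabilityMeasure μ]
    (hμν : μ ≠ ν) (hfin : klDiv μ ν < ⊤) :
    klDiv ((μ.conv (gaussianReal 0 ⟨σ ^ 2, sq_nonneg σ⟩)).bind
        (condDistrib X (fun ω => X ω + Z ω) P)) ν < klDiv μ ν := by
  refine klDiv_bind_condDistrib_conv_lt hX hZ hindep hXlaw hZlaw
    (gaussianReal_absolutelyContinuous' 0 ?_) hμν hfin
  exact fun h ↦ (pow_pos hσ 2).ne' (congrArg NNReal.toReal h)
end

section
/- Let σ > 0, let γ_σ be the Gaussian probability measure on ℝ with mean 0 and variance σ², let ν be a probability measure on ℝ, and let T : ℝ ≃ ℝ be a measurable equivalence such that T_*(ν ∗ γ_σ) = ν (an exact deterministic denoiser for ν at noise level σ, as provided by the probability-flow ODE). Then for every probability measure μ on ℝ, KL(T_*(μ ∗ γ_σ) ‖ ν) = KL(μ ∗ γ_σ ‖ ν ∗ γ_σ) ≤ KL(μ ‖ ν). (The paper's Theorem 1 with the denoiser Φ taken to be an exact deterministic invertible ODE-type denoiser: the denoising step preserves KL and the noising step does not increase it.) -/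
open MeasureTheory ProbabilityTheory

lemma klDiv_eq_coe_klDiv {α : Type*} [MeasurableSpace α] (μ ν : Measure α)
    [IsProbabilityMeasure μ] [IsProbabilityMeasure ν] :
    klDiv μ ν = ((InformationTheory.klDiv μ ν : ENNReal) : EReal) := by
  unfold klDiv
  split_ifs with h
  · rw [← InformationTheory.toReal_klDiv_of_measure_eq h.1 (by simp),
      EReal.coe_ennreal_toReal (InformationTheory.klDiv_ne_top h.1 h.2)]
  · rw [InformationTheory.klDiv_eq_top_iff.2 (fun h₁ h₂ => h ⟨h₁, h₂⟩), EReal.coe_ennreal_top]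

lemma klDiv_map_measurableEquiv {α β : Type*} [MeasurableSpace α] [MeasurableSpace β]
    (e : α ≃ᵐ β) (μ ν : Measure α) [IsFiniteMeasure μ] [IsFiniteMeasure ν] :
    InformationTheory.klDiv (μ.map e) (ν.map e) = InformationTheory.klDiv μ ν := by
  refine le_antisymm (InformationTheory.klDiv_map_le _ _ e.measurable) ?_
  simpa using InformationTheory.klDiv_map_le (μ.map e) (ν.map e) e.symm.measurable

lemma klDiv_conv_right_le {M : Type*} [AddMonoid M] [MeasurableSpace M] [MeasurableAdd₂ M]
    (μ ν γ : Measure M) [IsFiniteMeasure μ] [IsFiniteMeasure ν] [IsProbabilityMeasure γ] :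
    InformationTheory.klDiv (μ.conv γ) (ν.conv γ) ≤ InformationTheory.klDiv μ ν := by
  calc InformationTheory.klDiv (μ.conv γ) (ν.conv γ)
      ≤ InformationTheory.klDiv (μ.prod γ) (ν.prod γ) :=
        InformationTheory.klDiv_map_le _ _ measurable_add
    _ = InformationTheory.klDiv μ ν := by
        simpa using InformationTheory.klDiv_compProd_left μ ν (Kernel.const M γ)

/-- Theorem 1 of the paper with an exact deterministic invertible (ODE-type) denoiser
`T` for ν at noise level σ (i.e. `T` pushes the Gaussian-noised source law back to ν):
the denoising step preserves the KL divergence and the noising step does not increase it. -/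
theorem klDiv_map_conv_gaussian (σ : ℝ) (hσ : 0 < σ)
    (ν : Measure ℝ) [IsProbabilityMeasure ν] (T : ℝ ≃ᵐ ℝ)
    (hT : (ν.conv (gaussianReal 0 ⟨σ ^ 2, sq_nonneg σ⟩)).map T = ν) :
    ∀ (μ : Measure ℝ), IsProbabilityMeasure μ →
      klDiv ((μ.conv (gaussianReal 0 ⟨σ ^ 2, sq_nonneg σ⟩)).map T) ν
          = klDiv (μ.conv (gaussianReal 0 ⟨σ ^ 2, sq_nonneg σ⟩))
              (ν.conv (gaussianReal 0 ⟨σ ^ 2, sq_nonneg σ⟩)) ∧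
        klDiv (μ.conv (gaussianReal 0 ⟨σ ^ 2, sq_nonneg σ⟩))
            (ν.conv (gaussianReal 0 ⟨σ ^ 2, sq_nonneg σ⟩)) ≤ klDiv μ ν := by
  intro μ hμ
  set γ := gaussianReal 0 ⟨σ ^ 2, sq_nonneg σ⟩
  have : IsProbabilityMeasure γ := instIsProbabilityMeasureGaussianReal _ _
  have := Measure.isProbabilityMeasure_map (μ := μ.conv γ) T.measurable.aemeasurable
  refine ⟨?_, ?_⟩
  · rw [klDiv_eq_coe_klDiv, klDiv_eq_coe_klDiv, ← klDiv_map_measurableEquiv T (μ.conv γ), hT]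
  · rw [klDiv_eq_coe_klDiv, klDiv_eq_coe_klDiv]
    exact_mod_cast klDiv_conv_right_le μ ν γ
end
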